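/- arXiv:math/0110040 — 2 statements merged into one kernel-verified Lean document; each statement's English description precedes it below -/
import Mathlib

section
/- Let n ≥ 1, let π be a permutation of length n avoiding the pattern 1-3-2, let j be the position of the entry n, and let π' = (π_1,…,π_{j−1}) and π'' = (π_{j+1},…,π_n). Let s'(w) = Σ_{k≥2} f_k(w) denote the total number of almost 2-increasing subsequences of a sequence w of distinct integers. Then s'(π) = 2·s'(π') + s'(π'') + δ, where δ = 1 if π'' is nonempty and δ = 0 if π'' is empty. -/
/-- An occurrence of the classical pattern 1-3-2 in a sequence `w` of distinct
integers is a triple of indices `i < j < k` with `w i < w k < w j`;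
`w` avoids 1-3-2 if it has no such occurrence. -/
def Avoids132 {m : ℕ} (w : Fin m → ℤ) : Prop :=
  ∀ i j k : Fin m, i < j → j < k → ¬(w i < w k ∧ w k < w j)

/-- `π : Fin n → ℤ` is a permutation of length `n`, i.e. a sequence containing
each of the integers `1,…,n` exactly once. -/
def IsPermSeq (n : ℕ) (π : Fin n → ℤ) : Prop :=
  Function.Injective π ∧ ∀ i, 1 ≤ π i ∧ π i ≤ (n : ℤ)

/-- The prefix `π' = (π_1, …, π_{j-1})` of `π` strictly before position `j`. -/
def leftPart {n : ℕ} (π : Fin n → ℤ) (j : Fin n) : Fin (j : ℕ) → ℤ :=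
  fun a => π ⟨(a : ℕ), lt_trans a.isLt j.isLt⟩

/-- The suffix `π'' = (π_{j+1}, …, π_n)` of `π` strictly after position `j`. -/
def rightPart {n : ℕ} (π : Fin n → ℤ) (j : Fin n) : Fin (n - (j : ℕ) - 1) → ℤ :=
  fun a => π ⟨(j : ℕ) + 1 + (a : ℕ), by have h1 := a.isLt; have h2 := j.isLt; omega⟩

/-- An occurrence of the generalized pattern `12-3-…-k` in `w`:
indices `i 0 < i 1 < ⋯ < i (k-1)` with `i 1 = i 0 + 1` and
`w (i 0) < w (i 1) < ⋯ < w (i (k-1))`. -/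
def Occ12 {m : ℕ} (k : ℕ) (w : Fin m → ℤ) (i : Fin k → Fin m) : Prop :=
  StrictMono i ∧ StrictMono (w ∘ i) ∧
    ∀ a b : Fin k, (a : ℕ) = 0 → (b : ℕ) = 1 → (i b : ℕ) = (i a : ℕ) + 1

/-- The relative order of the letters of the pattern `21-3-…-k`. -/
def fPat (j : ℕ) : ℕ := if j = 0 then 1 else if j = 1 then 0 else j

/-- An occurrence of the generalized pattern `21-3-…-k` in `w`:
indices `i 0 < i 1 < ⋯ < i (k-1)` with `i 1 = i 0 + 1` and
`w (i 1) < w (i 0) < w (i 2) < ⋯ < w (i (k-1))`. -/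
def Occ21 {m : ℕ} (k : ℕ) (w : Fin m → ℤ) (i : Fin k → Fin m) : Prop :=
  StrictMono i ∧ (∀ a b : Fin k, fPat (a : ℕ) < fPat (b : ℕ) ↔ w (i a) < w (i b)) ∧
    ∀ a b : Fin k, (a : ℕ) = 0 → (b : ℕ) = 1 → (i b : ℕ) = (i a : ℕ) + 1

/-- `eStat k w` is the number of occurrences of the generalized pattern
`12-3-…-k` in `w` (for `k = 2` this is the number of ascents). -/
noncomputable def eStat (k : ℕ) {m : ℕ} (w : Fin m → ℤ) : ℕ :=
  Nat.card {i : Fin k → Fin m // Occ12 k w i}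

/-- `fStat k w` is the number of occurrences of the generalized pattern
`21-3-…-k` in `w` (for `k = 2` this is the number of descents). -/
noncomputable def fStat (k : ℕ) {m : ℕ} (w : Fin m → ℤ) : ℕ :=
  Nat.card {i : Fin k → Fin m // Occ21 k w i}

/-- The number of ascents of `w`: indices `i` with `w i < w (i+1)`. -/
noncomputable def asc {m : ℕ} (w : Fin m → ℤ) : ℕ :=
  Nat.card {p : Fin m × Fin m // (p.2 : ℕ) = (p.1 : ℕ) + 1 ∧ w p.1 < w p.2}

/-- The number of descents of `w`: indices `i` with `w i > w (i+1)`. -/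
noncomputable def des {m : ℕ} (w : Fin m → ℤ) : ℕ :=
  Nat.card {p : Fin m × Fin m // (p.2 : ℕ) = (p.1 : ℕ) + 1 ∧ w p.2 < w p.1}

/-- `totE w = Σ_{k ≥ 2} e_k(w)`: the total number of 2-increasing
subsequences of `w`. -/
noncomputable def totE {m : ℕ} (w : Fin m → ℤ) : ℕ :=
  Nat.card ((k : ℕ) × {i : Fin k → Fin m // 2 ≤ k ∧ Occ12 k w i})

/-- `totF w = Σ_{k ≥ 2} f_k(w)`: the total number of almost 2-increasing
subsequences of `w`. -/
noncomputable def totF {m : ℕ} (w : Fin m → ℤ) : ℕ :=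
  Nat.card ((k : ℕ) × {i : Fin k → Fin m // 2 ≤ k ∧ Occ21 k w i})

/-- `T` is the set of positions of an almost 2-increasing subsequence of `w`. -/
def IsAlmostIncSupport {m : ℕ} (w : Fin m → ℤ) (T : Finset (Fin m)) : Prop :=
  ∃ p ∈ T, ∃ q ∈ T, (q : ℕ) = (p : ℕ) + 1 ∧ w q < w p ∧
    (∀ x ∈ T, x = p ∨ x = q ∨ (q < x ∧ w p < w x)) ∧
    ∀ x ∈ T, ∀ y ∈ T, q < x → x < y → w x < w y

theorem Occ21.isAlmostIncSupport {m k : ℕ} {w : Fin m → ℤ} {i : Fin k → Fin m} (hk : 2 ≤ k)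
    (h : Occ21 k w i) : IsAlmostIncSupport w (Finset.univ.image i) := by
  obtain ⟨hi, hw, hadj⟩ := h
  have h01 := hadj ⟨0, by omega⟩ ⟨1, by omega⟩ rfl rfl
  refine ⟨i ⟨0, by omega⟩, by simp, i ⟨1, by omega⟩, by simp, h01, ?_, ?_, ?_⟩
  · exact (hw _ _).1 (by simp [fPat])
  · intro x hx
    obtain ⟨a, -, rfl⟩ := Finset.mem_image.1 hx
    by_cases h0 : (a : ℕ) = 0
    · exact Or.inl (congrArg i (Fin.ext h0))
    by_cases h1 : (a : ℕ) = 1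
    · exact Or.inr (Or.inl (congrArg i (Fin.ext h1)))
    refine Or.inr (Or.inr ⟨hi (Fin.lt_def.2 (by simp only; omega)), (hw _ _).1 ?_⟩)
    simp only [fPat, if_true, if_neg h0, if_neg h1]
    omega
  · intro x hx y hy hqx hxy
    obtain ⟨a, -, rfl⟩ := Finset.mem_image.1 hx
    obtain ⟨b, -, rfl⟩ := Finset.mem_image.1 hy
    have ha := Fin.lt_def.1 (hi.lt_iff_lt.1 hqx)
    have hb := Fin.lt_def.1 (hi.lt_iff_lt.1 hxy)
    simp only at ha
    refine (hw _ _).1 ?_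
    simp only [fPat]
    split_ifs <;> omega

theorem IsAlmostIncSupport.two_le_card {m : ℕ} {w : Fin m → ℤ} {T : Finset (Fin m)}
    (h : IsAlmostIncSupport w T) : 2 ≤ T.card := by
  obtain ⟨p, hp, q, hq, hpq, -⟩ := h
  exact Finset.one_lt_card.2 ⟨p, hp, q, hq, fun e => by subst e; omega⟩

theorem IsAlmostIncSupport.occ21 {m : ℕ} {w : Fin m → ℤ} {T : Finset (Fin m)}
    (h : IsAlmostIncSupport w T) : Occ21 T.card w (T.orderEmbOfFin rfl) := by
  have hk := h.two_le_card
  obtain ⟨p, hp, q, hq, hpq, hwqp, hT, hinc⟩ := h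
  set e := T.orderEmbOfFin rfl with he
  have hmem : ∀ a, e a ∈ T := fun a => T.orderEmbOfFin_mem rfl a
  have hsurj : ∀ x ∈ T, ∃ a, e a = x := fun x hx => by
    have : x ∈ Set.range e := by rw [he, Finset.range_orderEmbOfFin]; exact hx
    exact this
  have hlt : ∀ a b, e a < e b ↔ (a : ℕ) < b := fun a b => e.lt_iff_lt
  obtain ⟨a, ha⟩ := hsurj p hp
  obtain ⟨b, hb⟩ := hsurj q hq
  have ha0 : (a : ℕ) = 0 := by
    by_contra h0
    have h1 := (hlt ⟨0, by omega⟩ a).2 (by simp only; omega)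
    have h2 := hT _ (hmem ⟨0, by omega⟩)
    grind
  have hb1 : (b : ℕ) = 1 := by
    have hab := (hlt a b).1 (by rw [ha, hb]; exact Fin.lt_def.2 (by omega))
    by_contra h0
    have h1 := (hlt ⟨1, by omega⟩ b).2 (by simp only; omega)
    have h2 := (hlt a ⟨1, by omega⟩).2 (by simp only; omega)
    have h3 := hT _ (hmem ⟨1, by omega⟩)
    grind
  have hzero : ∀ c : Fin T.card, (c : ℕ) = 0 → e c = p := fun c hc => by
    rw [← ha]; exact congrArg e (Fin.ext (by omega))
  have hone : ∀ c : Fin T.card, (c : ℕ) = 1 → e c = q := fun c hc => by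
    rw [← hb]; exact congrArg e (Fin.ext (by omega))
  have hlater : ∀ c : Fin T.card, 2 ≤ (c : ℕ) → q < e c ∧ w p < w (e c) := fun c hc => by
    have h1 : q < e c := by rw [← hb]; exact (hlt _ _).2 (by omega)
    have h2 := hT _ (hmem c)
    grind
  have hmono : ∀ c d, fPat (c : Fin T.card) < fPat (d : Fin T.card) → w (e c) < w (e d) := by
    intro c d hcd
    rcases (by omega : (c : ℕ) = 0 ∨ (c : ℕ) = 1 ∨ 2 ≤ (c : ℕ)) with hc | hc | hc <;>
    rcases (by omega : (d : ℕ) = 0 ∨ (d : ℕ) = 1 ∨ 2 ≤ (d : ℕ)) with hd | hd | hd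
    · simp [fPat, hc, hd] at hcd
    · simp [fPat, hc, hd] at hcd
    · rw [hzero c hc]; exact (hlater d hd).2
    · rw [hone c hc, hzero d hd]; exact hwqp
    · simp [fPat, hc, hd] at hcd
    · rw [hone c hc]; exact hwqp.trans (hlater d hd).2
    · simp only [fPat] at hcd; split_ifs at hcd <;> omega
    · simp only [fPat] at hcd; split_ifs at hcd <;> omega
    · refine hinc _ (hmem c) _ (hmem d) (hlater c hc).1 ((hlt c d).2 ?_)
      simp only [fPat] at hcd; split_ifs at hcd <;> omega
  refine ⟨e.strictMono, fun c d => ⟨hmono c d, fun hcd => ?_⟩, fun c d hc hd => ?_⟩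
  · by_contra hn
    rcases (not_lt.1 hn).lt_or_eq with hlt' | heq
    · exact lt_asymm hcd (hmono d c hlt')
    · have : c = d := Fin.ext (by simp only [fPat] at heq; split_ifs at heq <;> omega)
      exact absurd hcd (by rw [this]; exact lt_irrefl _)
  · rw [hzero c hc, hone d hd]; exact hpq

theorem totF_eq_ncard {m : ℕ} (w : Fin m → ℤ) :
    totF w = {T : Finset (Fin m) | IsAlmostIncSupport w T}.ncard := by
  rw [← Nat.card_coe_set_eq]
  refine Nat.card_congr (Equiv.ofBijective
    (fun x => ⟨Finset.univ.image x.2.1, x.2.2.2.isAlmostIncSupport x.2.2.1⟩) ⟨?_, ?_⟩)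
  · rintro ⟨k, i, hk, hi⟩ ⟨l, i', hl, hi'⟩ h
    have h : Finset.univ.image i = Finset.univ.image i' := congrArg Subtype.val h
    have hc := congrArg Finset.card h
    rw [Finset.card_image_of_injective _ hi.1.injective,
      Finset.card_image_of_injective _ hi'.1.injective, Finset.card_fin, Finset.card_fin] at hc
    subst hc
    have hcard : (Finset.univ.image i).card = k := by
      rw [Finset.card_image_of_injective _ hi.1.injective, Finset.card_fin]
    have h1 := Finset.orderEmbOfFin_unique hcard (f := i) (fun x => by simp) hi.1
    have h2 := Finset.orderEmbOfFin_unique hcard (f := i') (fun x => by rw [h]; simp) hi'.1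
    obtain rfl := h1.trans h2.symm
    rfl
  · rintro ⟨T, hT⟩
    refine ⟨⟨T.card, T.orderEmbOfFin rfl, IsAlmostIncSupport.two_le_card hT,
      IsAlmostIncSupport.occ21 hT⟩, Subtype.ext ?_⟩
    exact Finset.image_orderEmbOfFin_univ T rfl

theorem isAlmostIncSupport_map {m n : ℕ} (e : Fin m ↪o Fin n)
    (hadj : ∀ a b, (e b : ℕ) = e a + 1 ↔ (b : ℕ) = a + 1) (w : Fin n → ℤ) (T : Finset (Fin m)) :
    IsAlmostIncSupport w (T.map e.toEmbedding) ↔ IsAlmostIncSupport (fun a => w (e a)) T := by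
  simp [IsAlmostIncSupport, hadj]

theorem exists_map_eq_of_forall_mem_range {α β : Type*} [Fintype α] [DecidableEq β] (f : α ↪ β)
    (T : Finset β) (h : ∀ x ∈ T, ∃ a, f a = x) : ∃ S : Finset α, S.map f = T := by
  refine ⟨Finset.univ.filter (f · ∈ T), ?_⟩
  ext x
  simp only [Finset.mem_map, Finset.mem_filter, Finset.mem_univ, true_and]
  constructor
  · rintro ⟨a, ha, rfl⟩; exact ha
  · intro hx; obtain ⟨a, rfl⟩ := h x hx; exact ⟨a, hx, rfl⟩

/-- The inclusion of the positions before `j`. -/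
def leftEmb {n : ℕ} (j : Fin n) : Fin (j : ℕ) ↪o Fin n :=
  Fin.castLEOrderEmb j.isLt.le

/-- The inclusion of the positions after `j`. -/
def rightEmb {n : ℕ} (j : Fin n) : Fin (n - (j : ℕ) - 1) ↪o Fin n :=
  OrderEmbedding.ofStrictMono (fun a => ⟨(j : ℕ) + 1 + a, by omega⟩)
    fun a b hab => by simp only [Fin.lt_def] at hab ⊢; omega

theorem leftEmb_val {n : ℕ} (j : Fin n) (a) : (leftEmb j a : ℕ) = a := rfl

theorem rightEmb_val {n : ℕ} (j : Fin n) (a) : (rightEmb j a : ℕ) = j + 1 + a := rfl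

theorem isAlmostIncSupport_map_leftEmb {n : ℕ} (π : Fin n → ℤ) (j : Fin n) (T) :
    IsAlmostIncSupport π (T.map (leftEmb j).toEmbedding) ↔
      IsAlmostIncSupport (leftPart π j) T :=
  isAlmostIncSupport_map _ (fun a b => by simp only [leftEmb_val]) _ _

theorem isAlmostIncSupport_map_rightEmb {n : ℕ} (π : Fin n → ℤ) (j : Fin n) (T) :
    IsAlmostIncSupport π (T.map (rightEmb j).toEmbedding) ↔
      IsAlmostIncSupport (rightPart π j) T :=
  isAlmostIncSupport_map _ (fun a b => by simp only [rightEmb_val]; omega) _ _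

theorem lt_of_mem_map_leftEmb {n : ℕ} {j x : Fin n} {S}
    (hx : x ∈ Finset.map (leftEmb j).toEmbedding S) : x < j := by
  obtain ⟨a, -, rfl⟩ := Finset.mem_map.1 hx
  exact a.isLt

theorem lt_of_mem_map_rightEmb {n : ℕ} {j x : Fin n} {S}
    (hx : x ∈ Finset.map (rightEmb j).toEmbedding S) : j < x := by
  obtain ⟨a, -, rfl⟩ := Finset.mem_map.1 hx
  exact Fin.lt_def.2 (by simp [rightEmb_val]; omega)

theorem exists_map_leftEmb {n : ℕ} {j : Fin n} {T : Finset (Fin n)} (h : ∀ x ∈ T, x < j) :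
    ∃ S, Finset.map (leftEmb j).toEmbedding S = T :=
  exists_map_eq_of_forall_mem_range _ T fun x hx => ⟨⟨x, h x hx⟩, rfl⟩

theorem exists_map_rightEmb {n : ℕ} {j : Fin n} {T : Finset (Fin n)} (h : ∀ x ∈ T, j < x) :
    ∃ S, Finset.map (rightEmb j).toEmbedding S = T :=
  exists_map_eq_of_forall_mem_range _ T fun x hx => by
    have := Fin.lt_def.1 (h x hx)
    exact ⟨⟨x - (j + 1), by omega⟩, Fin.ext (by
      show (j : ℕ) + 1 + (x - (j + 1)) = x
      omega)⟩

theorem IsAlmostIncSupport.insert_max {n : ℕ} {w : Fin n → ℤ} {j : Fin n}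
    (hmax : ∀ x, x ≠ j → w x < w j) {T : Finset (Fin n)} (hT : ∀ x ∈ T, x < j)
    (h : IsAlmostIncSupport w T) : IsAlmostIncSupport w (insert j T) := by
  obtain ⟨p, hp, q, hq, hpq, hw, hall, hinc⟩ := h
  refine ⟨p, Finset.mem_insert_of_mem hp, q, Finset.mem_insert_of_mem hq, hpq, hw, ?_, ?_⟩
  · intro x hx
    rcases Finset.mem_insert.1 hx with rfl | hx
    · exact Or.inr (Or.inr ⟨hT q hq, hmax p (hT p hp).ne⟩)
    · exact hall x hx
  · intro x hx y hy hqx hxy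
    rcases Finset.mem_insert.1 hx with rfl | hx <;> rcases Finset.mem_insert.1 hy with rfl | hy
    · exact absurd hxy (lt_irrefl _)
    · exact absurd hxy (hT y hy).asymm
    · exact hmax x hxy.ne
    · exact hinc x hx y hy hqx hxy

theorem isAlmostIncSupport_pair {n : ℕ} {w : Fin n → ℤ} {p q : Fin n}
    (hpq : (q : ℕ) = p + 1) (hw : w q < w p) : IsAlmostIncSupport w {p, q} := by
  refine ⟨p, by simp, q, by simp, hpq, hw, by simp, ?_⟩
  have hlt : p < q := Fin.lt_def.2 (by omega)
  intro x hx y hy hqx hxy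
  simp only [Finset.mem_insert, Finset.mem_singleton] at hx hy
  grind

/-- In a 1-3-2-avoiding sequence with maximum at `j`, the almost 2-increasing subsequences either
lie before `j`, or lie before `j` up to a final entry at `j`, or lie after `j`, or are the descent
at `j`. -/
theorem isAlmostIncSupport_iff {n : ℕ} {π : Fin n → ℤ} {j : Fin n}
    (havoid : Avoids132 π) (hmax : ∀ x, x ≠ j → π x < π j) (T : Finset (Fin n)) :
    IsAlmostIncSupport π T ↔
      (∃ S, IsAlmostIncSupport (leftPart π j) S ∧ S.map (leftEmb j).toEmbedding = T) ∨
      (∃ S, IsAlmostIncSupport (leftPart π j) S ∧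
        insert j (S.map (leftEmb j).toEmbedding) = T) ∨
      (∃ S, IsAlmostIncSupport (rightPart π j) S ∧ S.map (rightEmb j).toEmbedding = T) ∨
      ∃ q : Fin n, (q : ℕ) = j + 1 ∧ T = {j, q} := by
  constructor
  · intro h
    have h' := h
    obtain ⟨p, hp, q, hq, hpq, hw, hall, hinc⟩ := h'
    have hltpq : p < q := Fin.lt_def.2 (by omega)
    rcases lt_trichotomy p j with hpj | rfl | hjp
    · have hqj : q < j := by
        refine lt_of_le_of_ne (Fin.le_def.2 (by have := Fin.lt_def.1 hpj; omega)) ?_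
        rintro rfl
        exact hw.asymm (hmax p hpj.ne)
      have hle : ∀ x ∈ T, x ≤ j := by
        intro x hx
        by_contra! hjx
        rcases hall x hx with rfl | rfl | ⟨-, h2⟩
        · exact hpj.asymm hjx
        · exact hqj.asymm hjx
        · exact havoid p j x hpj hjx ⟨h2, hmax x hjx.ne'⟩
      have herase : IsAlmostIncSupport π (T.erase j) :=
        ⟨p, Finset.mem_erase.2 ⟨hpj.ne, hp⟩, q, Finset.mem_erase.2 ⟨hqj.ne, hq⟩, hpq, hw,
          fun x hx => hall x (Finset.mem_of_mem_erase hx),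
          fun x hx y hy => hinc x (Finset.mem_of_mem_erase hx) y (Finset.mem_of_mem_erase hy)⟩
      obtain ⟨S, hS⟩ := exists_map_leftEmb (T := T.erase j) (j := j) fun x hx =>
        lt_of_le_of_ne (hle x (Finset.mem_of_mem_erase hx)) (Finset.ne_of_mem_erase hx)
      have hSleft := (isAlmostIncSupport_map_leftEmb π j S).1 (hS ▸ herase)
      by_cases hj : j ∈ T
      · exact Or.inr (Or.inl ⟨S, hSleft, by rw [hS, Finset.insert_erase hj]⟩)
      · exact Or.inl ⟨S, hSleft, by rw [hS, Finset.erase_eq_of_notMem hj]⟩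
    · refine Or.inr (Or.inr (Or.inr ⟨q, hpq, ?_⟩))
      ext x
      simp only [Finset.mem_insert, Finset.mem_singleton]
      constructor
      · intro hx
        rcases hall x hx with h1 | h1 | ⟨h1, h2⟩
        · exact Or.inl h1
        · exact Or.inr h1
        · exact absurd (hmax x (hltpq.trans h1).ne') h2.asymm
      · rintro (rfl | rfl) <;> assumption
    · obtain ⟨S, rfl⟩ := exists_map_rightEmb (T := T) (j := j) fun x hx => by
        rcases hall x hx with rfl | rfl | ⟨h1, -⟩
        · exact hjp
        · exact hjp.trans hltpq
        · exact (hjp.trans hltpq).trans h1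
      exact Or.inr (Or.inr (Or.inl ⟨S, (isAlmostIncSupport_map_rightEmb π j S).1 h, rfl⟩))
  · rintro (⟨S, hS, rfl⟩ | ⟨S, hS, rfl⟩ | ⟨S, hS, rfl⟩ | ⟨q, hq, rfl⟩)
    · exact (isAlmostIncSupport_map_leftEmb π j S).2 hS
    · exact ((isAlmostIncSupport_map_leftEmb π j S).2 hS).insert_max hmax
        fun x hx => lt_of_mem_map_leftEmb hx
    · exact (isAlmostIncSupport_map_rightEmb π j S).2 hS
    · exact isAlmostIncSupport_pair hq (hmax q fun h => by subst h; omega)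

theorem ncard_setOf_eq_descent {n : ℕ} (j : Fin n) :
    {T : Finset (Fin n) | ∃ q : Fin n, (q : ℕ) = j + 1 ∧ T = {j, q}}.ncard =
      if (j : ℕ) + 1 < n then 1 else 0 := by
  split_ifs with h
  · rw [Set.ncard_eq_one]
    refine ⟨{j, ⟨j + 1, h⟩}, Set.ext fun T => ⟨?_, ?_⟩⟩
    · rintro ⟨q, hq, rfl⟩
      obtain rfl : q = ⟨j + 1, h⟩ := Fin.ext hq
      rfl
    · rintro rfl
      exact ⟨_, rfl, rfl⟩
  · rw [Set.ncard_eq_zero]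
    refine Set.eq_empty_of_forall_notMem ?_
    rintro T ⟨q, hq, -⟩
    omega

/-- If `π ∈ S_n(1-3-2)` has its maximal entry at position `j`,
and `s'(w)` denotes the total number of almost 2-increasing subsequences of
`w`, then `s'(π) = 2·s'(π') + s'(π'') + δ`, where `δ = 1` iff `π''` is
nonempty. -/
theorem totF_decomposition (n : ℕ) (hn : 1 ≤ n) (π : Fin n → ℤ)
    (hperm : IsPermSeq n π) (havoid : Avoids132 π)
    (j : Fin n) (hj : π j = (n : ℤ)) :
    totF π = 2 * totF (leftPart π j) + totF (rightPart π j) +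
      (if (j : ℕ) + 1 < n then 1 else 0) := by
  have hmax : ∀ x, x ≠ j → π x < π j := fun x hx =>
    lt_of_le_of_ne (hj ▸ (hperm.2 x).2) (hperm.1.ne hx)
  set A := {S | IsAlmostIncSupport (leftPart π j) S} with hA
  set B := {S | IsAlmostIncSupport (rightPart π j) S} with hB
  let f : Finset (Fin j) → Finset (Fin n) := fun S => S.map (leftEmb j).toEmbedding
  let g : Finset (Fin (n - j - 1)) → Finset (Fin n) :=
    fun S => S.map (rightEmb j).toEmbedding
  let D := {T : Finset (Fin n) | ∃ q : Fin n, (q : ℕ) = j + 1 ∧ T = {j, q}}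
  have hunion : {T | IsAlmostIncSupport π T} =
      f '' A ∪ ((fun S => insert j (f S)) '' A ∪ (g '' B ∪ D)) :=
    Set.ext (isAlmostIncSupport_iff havoid hmax)
  have hjf : ∀ S, j ∉ f S := fun S h => lt_irrefl _ (lt_of_mem_map_leftEmb h)
  have hjg : ∀ S, j ∉ g S := fun S h => lt_irrefl _ (lt_of_mem_map_rightEmb h)
  have hfinj : Function.Injective f := Finset.map_injective _
  have hfinj' : Function.Injective fun S => insert j (f S) := fun S S' h => hfinj <| by
    rw [← Finset.erase_insert (hjf S), ← Finset.erase_insert (hjf S')]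
    exact congrArg (Finset.erase · j) h
  have hginj : Function.Injective g := Finset.map_injective _
  have hdisj₁ : Disjoint (g '' B) D := by
    rw [Set.disjoint_left]
    rintro _ ⟨S, -, rfl⟩ ⟨q, -, h⟩
    exact hjg S (h ▸ Finset.mem_insert_self _ _)
  have hdisj₂ : Disjoint ((fun S => insert j (f S)) '' A) (g '' B ∪ D) := by
    rw [Set.disjoint_left]
    rintro _ ⟨S, hS, rfl⟩ (⟨S', -, h⟩ | ⟨q, hq, h⟩)
    · exact hjg S' (h ▸ Finset.mem_insert_self _ _)
    · have hqS : q ∈ insert j (f S) := by simp only at h; rw [h]; simp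
      rcases Finset.mem_insert.1 hqS with rfl | hqS
      · omega
      · have := Fin.lt_def.1 (lt_of_mem_map_leftEmb hqS)
        omega
  have hdisj₃ : Disjoint (f '' A) ((fun S => insert j (f S)) '' A ∪ (g '' B ∪ D)) := by
    rw [Set.disjoint_left]
    rintro _ ⟨S, hS, rfl⟩ (⟨S', -, h⟩ | ⟨S', -, h⟩ | ⟨q, -, h⟩)
    · exact hjf S (h ▸ Finset.mem_insert_self _ _)
    · obtain ⟨p, hp, -⟩ := hS
      have hmem : leftEmb j p ∈ f S := Finset.mem_map_of_mem _ hp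
      exact (lt_of_mem_map_leftEmb hmem).asymm (lt_of_mem_map_rightEmb (h ▸ hmem))
    · exact hjf S (h ▸ Finset.mem_insert_self _ _)
  rw [totF_eq_ncard, totF_eq_ncard, totF_eq_ncard, hunion, Set.ncard_union_eq hdisj₃,
    Set.ncard_union_eq hdisj₂, Set.ncard_union_eq hdisj₁, Set.ncard_image_of_injective _ hfinj,
    Set.ncard_image_of_injective _ hfinj', Set.ncard_image_of_injective _ hginj,
    ncard_setOf_eq_descent, ← hA, ← hB]
  omega
end

section
/- For n ≥ 0 define the polynomial P_n(x) = Σ_{π ∈ S_n(1-3-2)} x^{s(π)} (with P_0 = 1), where s(π) is the total number of 2-increasing subsequences of π. Then for all n ≥ 0, P_{n+1}(x) = P_n(x) + x · Σ_{a+b=n, a≥1} P_a(x²)·P_b(x), where P_a(x²) denotes the polynomial P_a with x replaced by x². -/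
open Classical in
/-- The supports of the 2-increasing subsequences of `u 0, …, u (n-1)`. -/
noncomputable def twoIncSupports (n : ℕ) (u : ℕ → ℤ) : Finset (Finset ℕ) :=
  (Finset.range n).powerset.filter fun S =>
    StrictMonoOn u S ∧ ∃ i ∈ S, i + 1 ∈ S ∧ ∀ x ∈ S, i ≤ x

theorem mem_twoIncSupports {n : ℕ} {u : ℕ → ℤ} {S : Finset ℕ} :
    S ∈ twoIncSupports n u ↔ (∀ x ∈ S, x < n) ∧ StrictMonoOn u S ∧
      ∃ i ∈ S, i + 1 ∈ S ∧ ∀ x ∈ S, i ≤ x := by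
  simp [twoIncSupports, Finset.subset_iff]

theorem twoIncSupports_congr {n : ℕ} {u v : ℕ → ℤ}
    (h : ∀ i < n, ∀ j < n, u i < u j ↔ v i < v j) :
    twoIncSupports n u = twoIncSupports n v := by
  ext S
  rw [mem_twoIncSupports, mem_twoIncSupports]
  refine and_congr_right fun hS => and_congr_left fun _ => ?_
  exact ⟨fun hu i hi j hj hij => (h i (hS i hi) j (hS j hj)).1 (hu hi hj hij),
    fun hv i hi j hj hij => (h i (hS i hi) j (hS j hj)).2 (hv hi hj hij)⟩

theorem Occ12.image_mem_twoIncSupports {n k : ℕ} {u : ℕ → ℤ} {i : Fin k → Fin n} (hk : 2 ≤ k)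
    (hi : Occ12 k (fun x : Fin n => u x) i) :
    Finset.univ.image (fun x => (i x : ℕ)) ∈ twoIncSupports n u := by
  obtain ⟨hmono, hinc, hadj⟩ := hi
  rw [mem_twoIncSupports]
  refine ⟨by simp, ?_, i ⟨0, by omega⟩, by simp, ?_, ?_⟩
  · intro x hx y hy hxy
    simp only [Finset.coe_image, Finset.coe_univ, Set.image_univ, Set.mem_range] at hx hy
    obtain ⟨p, rfl⟩ := hx
    obtain ⟨q, rfl⟩ := hy
    exact hinc (hmono.lt_iff_lt.1 hxy)
  · rw [← hadj ⟨0, by omega⟩ ⟨1, by omega⟩ rfl rfl]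
    exact Finset.mem_image_of_mem _ (Finset.mem_univ _)
  · intro x hx
    obtain ⟨p, -, rfl⟩ := Finset.mem_image.1 hx
    exact hmono.monotone (Fin.mk_le_of_le_val (Nat.zero_le _))

theorem StrictMono.eq_of_image_eq {n k : ℕ} {i j : Fin k → Fin n}
    (hi : StrictMono i) (hj : StrictMono j)
    (h : Finset.univ.image (fun x => (i x : ℕ)) = Finset.univ.image (fun x => (j x : ℕ))) :
    i = j := by
  have hi' : StrictMono fun x => (i x : ℕ) := hi
  have hj' : StrictMono fun x => (j x : ℕ) := hj
  have hr : Set.range (fun x => (i x : ℕ)) = Set.range fun x => (j x : ℕ) := by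
    simpa using congrArg (fun S : Finset ℕ => (S : Set ℕ)) h
  have := (StrictMono.range_inj hi' hj').1 hr
  funext x
  exact Fin.ext (congrFun this x)

theorem exists_occ12_of_mem_twoIncSupports {n : ℕ} {u : ℕ → ℤ} {S : Finset ℕ}
    (hS : S ∈ twoIncSupports n u) :
    ∃ i : Fin S.card → Fin n, 2 ≤ S.card ∧ Occ12 S.card (fun x : Fin n => u x) i ∧
      Finset.univ.image (fun x => (i x : ℕ)) = S := by
  obtain ⟨hlt, hinc, m, hm, hm1, hmin⟩ := mem_twoIncSupports.1 hS
  have hmem := fun x => S.orderEmbOfFin_mem rfl x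
  have hmono : StrictMono (S.orderEmbOfFin rfl) := (S.orderEmbOfFin rfl).strictMono
  have hrange : ∀ y ∈ S, ∃ x, S.orderEmbOfFin rfl x = y := by
    intro y hy
    have : y ∈ Set.range (S.orderEmbOfFin rfl) := by simpa using hy
    exact this
  refine ⟨fun x => ⟨S.orderEmbOfFin rfl x, hlt _ (hmem x)⟩, ?_, ⟨hmono, ?_, ?_⟩, ?_⟩
  · exact Finset.one_lt_card.2 ⟨m, hm, m + 1, hm1, by omega⟩
  · exact fun x y hxy => hinc (hmem x) (hmem y) (hmono hxy)
  · intro a b ha hb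
    obtain ⟨p, hp⟩ := hrange m hm
    obtain ⟨q, hq⟩ := hrange (m + 1) hm1
    have ham : S.orderEmbOfFin rfl a = m :=
      le_antisymm (hp ▸ hmono.monotone (Fin.le_def.2 (by omega))) (hmin _ (hmem a))
    have hab : a < b := Fin.lt_def.2 (by omega)
    have hpq : p < q := hmono.lt_iff_lt.1 (by omega)
    have hbq : b ≤ q := Fin.le_def.2 (by have := Fin.lt_def.1 hpq; omega)
    have h1 := hmono hab
    have h2 := hmono.monotone hbq
    change S.orderEmbOfFin rfl b = S.orderEmbOfFin rfl a + 1
    omega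
  · ext y
    simp only [Finset.mem_image, Finset.mem_univ, true_and]
    exact ⟨fun ⟨x, hx⟩ => hx ▸ hmem x, hrange y⟩

theorem totE_eq_card_twoIncSupports (n : ℕ) (u : ℕ → ℤ) :
    totE (fun x : Fin n => u x) = (twoIncSupports n u).card := by
  rw [totE, ← Nat.card_eq_finsetCard]
  refine Nat.card_eq_of_bijective (fun p => ⟨Finset.univ.image fun x => (p.2.1 x : ℕ),
    p.2.2.2.image_mem_twoIncSupports p.2.2.1⟩) ⟨?_, ?_⟩
  · rintro ⟨k, i, hk, hi⟩ ⟨l, j, hl, hj⟩ h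
    have h' : Finset.univ.image (fun x => (i x : ℕ)) = Finset.univ.image fun x => (j x : ℕ) :=
      congrArg Subtype.val h
    have hkl : k = l := by
      have hc := congrArg Finset.card h'
      have hi' : Function.Injective fun x => (i x : ℕ) := Fin.val_injective.comp hi.1.injective
      have hj' : Function.Injective fun x => (j x : ℕ) := Fin.val_injective.comp hj.1.injective
      rwa [Finset.card_image_of_injective _ hi', Finset.card_image_of_injective _ hj',
        Finset.card_fin, Finset.card_fin] at hc
    subst hkl
    obtain rfl := StrictMono.eq_of_image_eq hi.1 hj.1 h'
    rfl
  · rintro ⟨S, hS⟩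
    obtain ⟨i, hk, hi, himage⟩ := exists_occ12_of_mem_twoIncSupports hS
    exact ⟨⟨_, i, hk, hi⟩, Subtype.ext himage⟩

/-- `u 0, …, u (n-1)` is a permutation of `1, …, n` avoiding 1-3-2. -/
structure IsPerm132 (n : ℕ) (u : ℕ → ℤ) : Prop where
  inj : ∀ i < n, ∀ j < n, u i = u j → i = j
  pos : ∀ i < n, 1 ≤ u i
  le : ∀ i < n, u i ≤ n
  avoids : ∀ i j k, i < j → j < k → k < n → ¬(u i < u k ∧ u k < u j)

theorem isPerm132_iff (n : ℕ) (u : ℕ → ℤ) :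
    IsPerm132 n u ↔ IsPermSeq n (fun x : Fin n => u x) ∧ Avoids132 fun x : Fin n => u x := by
  constructor
  · rintro ⟨h1, h2, h3, h4⟩
    exact ⟨⟨fun x y h => Fin.ext (h1 x x.2 y y.2 h), fun x => ⟨h2 x x.2, h3 x x.2⟩⟩,
      fun i j k hij hjk => h4 i j k hij hjk k.2⟩
  · rintro ⟨⟨h1, h2⟩, h3⟩
    exact ⟨fun i hi j hj h => congrArg Fin.val (@h1 ⟨i, hi⟩ ⟨j, hj⟩ h),
      fun i hi => (h2 ⟨i, hi⟩).1, fun i hi => (h2 ⟨i, hi⟩).2,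
      fun i j k hij hjk hk => h3 ⟨i, by omega⟩ ⟨j, by omega⟩ ⟨k, hk⟩ hij hjk⟩

/-- The sequence `u + b` on `a` letters, followed by the letter `a + b + 1`, followed by `v`. -/
def glueMax (a b : ℕ) (u v : ℕ → ℤ) (i : ℕ) : ℤ :=
  if i < a then u i + b else if i = a then a + b + 1 else v (i - a - 1)

section glueMax

variable {a b i : ℕ} {u v w : ℕ → ℤ}

theorem glueMax_of_lt (h : i < a) : glueMax a b u v i = u i + b := if_pos h

@[simp] theorem glueMax_self : glueMax a b u v a = a + b + 1 := by simp [glueMax]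

@[simp] theorem glueMax_add : glueMax a b u v (i + a + 1) = v i := by
  rw [glueMax, if_neg (by omega), if_neg (by omega)]
  congr 1
  omega

theorem isPerm132_glueMax (hu : IsPerm132 a u) (hv : IsPerm132 b v) :
    IsPerm132 (a + b + 1) (glueMax a b u v) := by
  have key : ∀ i < a + b + 1,
      (i < a ∧ glueMax a b u v i = u i + b ∧ 1 ≤ u i ∧ u i ≤ a) ∨
      (i = a ∧ glueMax a b u v i = a + b + 1) ∨
      (a < i ∧ i - a - 1 < b ∧ glueMax a b u v i = v (i - a - 1) ∧
        1 ≤ v (i - a - 1) ∧ v (i - a - 1) ≤ b) := by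
    intro i hi
    rcases lt_trichotomy i a with h | rfl | h
    · exact Or.inl ⟨h, glueMax_of_lt h, hu.pos i h, hu.le i h⟩
    · exact Or.inr (Or.inl ⟨rfl, glueMax_self⟩)
    · have hb : i - a - 1 < b := by omega
      refine Or.inr (Or.inr ⟨h, hb, ?_, hv.pos _ hb, hv.le _ hb⟩)
      rw [glueMax, if_neg (by omega), if_neg (by omega)]
  refine ⟨fun i hi j hj h => ?_, fun i hi => ?_, fun i hi => ?_, fun i j k hij hjk hk h => ?_⟩
  · have hui := hu.inj i
    have hvi := hv.inj (i - a - 1)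
    rcases key i hi with ⟨h1, h2, h3, h4⟩ | ⟨h1, h2⟩ | ⟨h1, h2, h3, h4, h5⟩ <;>
    rcases key j hj with ⟨k1, k2, k3, k4⟩ | ⟨k1, k2⟩ | ⟨k1, k2, k3, k4, k5⟩ <;>
    first
    | omega
    | exact hui h1 j k1 (by omega)
    | (have := hvi h2 _ k2 (by omega); omega)
  · rcases key i hi with h | h | h <;> omega
  · push_cast
    rcases key i hi with h | h | h <;> omega
  · have hua := hu.avoids i j k hij hjk
    have hva := hv.avoids (i - a - 1) (j - a - 1) (k - a - 1)
    have := key i (by omega)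
    have := key j (by omega)
    have := key k hk
    omega

theorem IsPerm132.lt_of_lt_max (hw : IsPerm132 (a + b + 1) w) (ha : w a = a + b + 1) {i k : ℕ}
    (hi : i < a) (hk : a < k) (hkn : k < a + b + 1) : w k < w i := by
  have h1 := hw.avoids i a k hi hk hkn
  have h2 := hw.le k hkn
  have h3 := hw.inj k hkn a (by omega)
  have h4 := hw.inj k hkn i (by omega)
  push_cast at h2
  by_contra! h
  exact h1 ⟨lt_of_le_of_ne h fun h' => by have := h4 h'.symm; omega,
    lt_of_le_of_ne (by omega) fun h' => by have := h3 h'; omega⟩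

theorem IsPerm132.lt_max (hw : IsPerm132 (a + b + 1) w) (ha : w a = a + b + 1) {i : ℕ}
    (hi : i < a + b + 1) (hia : i ≠ a) : w i < w a := by
  have h2 := hw.le i hi
  push_cast at h2
  exact lt_of_le_of_ne (by omega) fun h => hia (hw.inj i hi a (by omega) h)

theorem IsPerm132.right_le (hw : IsPerm132 (a + b + 1) w) (ha : w a = a + b + 1) {k : ℕ}
    (hk : a < k) (hkn : k < a + b + 1) : w k ≤ b := by
  have hc : (Finset.range (a + 1)).card ≤ (Finset.Icc (w k + 1) (a + b + 1)).card := by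
    refine Finset.card_le_card_of_injOn w (fun i hi => ?_) fun i hi j hj h => ?_
    · have hi' : i < a + 1 := by simpa using hi
      have hle := hw.le i (by omega)
      push_cast at hle
      have : w k < w i := by
        rcases Nat.lt_succ_iff_lt_or_eq.1 hi' with h | rfl
        · exact hw.lt_of_lt_max ha h hk hkn
        · exact hw.lt_max ha hkn hk.ne'
      simp only [Finset.coe_Icc, Set.mem_Icc]
      omega
    · have hi' : i < a + 1 := by simpa using hi
      have hj' : j < a + 1 := by simpa using hj
      exact hw.inj i (by omega) j (by omega) h
  have := hw.le k hkn
  rw [Finset.card_range, Int.card_Icc] at hc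
  omega

theorem IsPerm132.lt_left (hw : IsPerm132 (a + b + 1) w) (ha : w a = a + b + 1) {i : ℕ}
    (hi : i < a) : (b : ℤ) < w i := by
  have hc : (Finset.range b).card ≤ (Finset.Icc 1 (w i - 1)).card := by
    refine Finset.card_le_card_of_injOn (fun k => w (k + a + 1)) (fun k hk => ?_)
      fun j hj k hk h => ?_
    · have hk' : k < b := by simpa using hk
      have h1 := hw.pos (k + a + 1) (by omega)
      have h2 := hw.lt_of_lt_max ha hi (show a < k + a + 1 by omega) (by omega)
      simp only [Finset.coe_Icc, Set.mem_Icc]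
      omega
    · have hj' : j < b := by simpa using hj
      have hk' : k < b := by simpa using hk
      have := hw.inj _ (by omega) _ (by omega) h
      omega
  have := hw.pos i (by omega)
  rw [Finset.card_range, Int.card_Icc] at hc
  omega

theorem IsPerm132.left (hw : IsPerm132 (a + b + 1) w) (ha : w a = a + b + 1) :
    IsPerm132 a fun i => w i - b where
  inj i hi j hj h := hw.inj i (by omega) j (by omega) (by omega)
  pos i hi := by have := hw.lt_left ha hi; omega
  le i hi := by
    have := hw.lt_max ha (i := i) (by omega) hi.ne
    omega
  avoids i j k hij hjk hk h := hw.avoids i j k hij hjk (by omega) (by omega)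

theorem IsPerm132.right (hw : IsPerm132 (a + b + 1) w) (ha : w a = a + b + 1) :
    IsPerm132 b fun i => w (i + a + 1) where
  inj i hi j hj h := by have := hw.inj _ (by omega) _ (by omega) h; omega
  pos i hi := hw.pos _ (by omega)
  le i hi := hw.right_le ha (by omega) (by omega)
  avoids i j k hij hjk hk h :=
    hw.avoids (i + a + 1) (j + a + 1) (k + a + 1) (by omega) (by omega) (by omega) h

theorem IsPerm132.mem_twoIncSupports_iff (hw : IsPerm132 (a + b + 1) w) (ha : w a = a + b + 1)
    (S : Finset ℕ) :
    S ∈ twoIncSupports (a + b + 1) w ↔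
      S ∈ twoIncSupports a w ∨ (∃ R ∈ twoIncSupports a w, insert a R = S) ∨
      (0 < a ∧ {a - 1, a} = S) ∨
      ∃ R ∈ twoIncSupports b fun i => w (i + a + 1),
        R.map (addRightEmbedding (a + 1)) = S := by
  have hmax := fun i => hw.lt_max ha (i := i)
  constructor
  · intro hS
    obtain ⟨hlt, hinc, m, hm, hm1, hmin⟩ := mem_twoIncSupports.1 hS
    have hsmall : ∀ i ∈ S, i ≤ a → ∀ k ∈ S, k ≤ a := by
      intro i hi hia k hk
      by_contra! hka
      have h1 := hinc hi hk (by omega)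
      rcases hia.lt_or_eq with h | rfl
      · exact (hw.lt_of_lt_max ha h hka (hlt k hk)).not_gt h1
      · exact (hmax k (hlt k hk) hka.ne').not_gt h1
    by_cases haS : a ∈ S
    · have hle := hsmall a haS le_rfl
      have hm1a := hle _ hm1
      rcases hm1a.lt_or_eq with h | h
      · refine Or.inr (Or.inl ⟨S.erase a, mem_twoIncSupports.2 ⟨?_, ?_, m, ?_, ?_, ?_⟩,
          Finset.insert_erase haS⟩)
        · intro x hx
          exact lt_of_le_of_ne (hle x (Finset.mem_of_mem_erase hx)) (Finset.ne_of_mem_erase hx)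
        · exact hinc.mono (by simp)
        · exact Finset.mem_erase.2 ⟨by omega, hm⟩
        · exact Finset.mem_erase.2 ⟨by omega, hm1⟩
        · exact fun x hx => hmin x (Finset.mem_of_mem_erase hx)
      · refine Or.inr (Or.inr (Or.inl ⟨by omega, ?_⟩))
        ext x
        simp only [Finset.mem_insert, Finset.mem_singleton]
        constructor
        · rintro (rfl | rfl)
          · rwa [← h, Nat.add_sub_cancel]
          · exact haS
        · intro hx
          have := hle x hx
          have := hmin x hx
          omega
    · rcases lt_trichotomy m a with h | rfl | h
      · refine Or.inl (mem_twoIncSupports.2 ⟨fun x hx => ?_, hinc, m, hm, hm1, hmin⟩)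
        exact lt_of_le_of_ne (hsmall m hm h.le x hx) fun h' => haS (h' ▸ hx)
      · exact absurd hm haS
      · have hmapmem : ∀ x, x ∈ S.image (fun y => y - (a + 1)) ↔ x + a + 1 ∈ S := by
          intro x
          simp only [Finset.mem_image]
          constructor
          · rintro ⟨y, hy, rfl⟩
            have := hmin y hy
            rwa [show y - (a + 1) + a + 1 = y by omega]
          · exact fun hx => ⟨_, hx, by omega⟩
        refine Or.inr (Or.inr (Or.inr ⟨S.image fun y => y - (a + 1),
          mem_twoIncSupports.2 ⟨?_, ?_, m - (a + 1), ?_, ?_, ?_⟩, ?_⟩))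
        · intro x hx
          have := hlt _ ((hmapmem x).1 hx)
          omega
        · intro x hx y hy hxy
          exact hinc ((hmapmem x).1 hx) ((hmapmem y).1 hy) (by omega)
        · rw [hmapmem, show m - (a + 1) + a + 1 = m by omega]
          exact hm
        · rw [hmapmem, show m - (a + 1) + 1 + a + 1 = m + 1 by omega]
          exact hm1
        · intro x hx
          have := hmin _ ((hmapmem x).1 hx)
          omega
        · ext x
          simp only [Finset.mem_map, hmapmem, addRightEmbedding_apply]
          constructor
          · rintro ⟨y, hy, rfl⟩
            exact hy
          · intro hx
            have := hmin x hx
            exact ⟨x - (a + 1), by rwa [show x - (a + 1) + a + 1 = x by omega], by omega⟩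
  · rintro (hS | ⟨R, hR, rfl⟩ | ⟨h0, rfl⟩ | ⟨R, hR, rfl⟩)
    · obtain ⟨hlt, h⟩ := mem_twoIncSupports.1 hS
      exact mem_twoIncSupports.2 ⟨fun x hx => by have := hlt x hx; omega, h⟩
    · obtain ⟨hlt, hinc, m, hm, hm1, hmin⟩ := mem_twoIncSupports.1 hR
      refine mem_twoIncSupports.2 ⟨?_, ?_, m, Finset.mem_insert_of_mem hm,
        Finset.mem_insert_of_mem hm1, ?_⟩
      · intro x hx
        rcases Finset.mem_insert.1 hx with rfl | hx
        · omega
        · have := hlt x hx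
          omega
      · intro x hx y hy hxy
        rcases Finset.mem_insert.1 hx with rfl | hx <;>
        rcases Finset.mem_insert.1 hy with rfl | hy
        · omega
        · have := hlt y hy
          omega
        · exact hmax x (by omega) hxy.ne
        · exact hinc hx hy hxy
      · intro x hx
        rcases Finset.mem_insert.1 hx with rfl | hx
        · exact (hlt m hm).le
        · exact hmin x hx
    · have hmem : ∀ x, x ∈ ({a - 1, a} : Finset ℕ) ↔ x = a - 1 ∨ x = a := by simp
      refine mem_twoIncSupports.2 ⟨?_, ?_, a - 1, by simp, ?_, ?_⟩
      · intro x hx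
        have := (hmem x).1 hx
        omega
      · intro x hx y hy hxy
        have := (hmem x).1 hx
        obtain rfl : y = a := by have := (hmem y).1 hy; omega
        exact hmax x (by omega) hxy.ne
      · rw [hmem]
        omega
      · intro x hx
        have := (hmem x).1 hx
        omega
    · obtain ⟨hlt, hinc, m, hm, hm1, hmin⟩ := mem_twoIncSupports.1 hR
      refine mem_twoIncSupports.2 ⟨?_, ?_, m + (a + 1), Finset.mem_map_of_mem _ hm, ?_, ?_⟩
      · intro x hx
        obtain ⟨y, hy, rfl⟩ := Finset.mem_map.1 hx
        have := hlt y hy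
        simp only [addRightEmbedding_apply]
        omega
      · intro x hx y hy hxy
        obtain ⟨p, hp, rfl⟩ := Finset.mem_map.1 hx
        obtain ⟨q, hq, rfl⟩ := Finset.mem_map.1 hy
        simp only [addRightEmbedding_apply] at hxy
        exact hinc hp hq (by omega)
      · rw [show m + (a + 1) + 1 = (m + 1) + (a + 1) by omega]
        exact Finset.mem_map_of_mem _ hm1
      · intro x hx
        obtain ⟨y, hy, rfl⟩ := Finset.mem_map.1 hx
        have := hmin y hy
        simp only [addRightEmbedding_apply]
        omega

theorem IsPerm132.card_twoIncSupports (hw : IsPerm132 (a + b + 1) w) (ha : w a = a + b + 1) :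
    (twoIncSupports (a + b + 1) w).card =
      2 * (twoIncSupports a w).card + (if 0 < a then 1 else 0) +
        (twoIncSupports b fun i => w (i + a + 1)).card := by
  set M : Finset (Finset ℕ) := if 0 < a then {{a - 1, a}} else ∅ with hM
  have hMmem : ∀ S, S ∈ M ↔ 0 < a ∧ {a - 1, a} = S := by
    intro S
    by_cases h : 0 < a <;> simp [hM, h, eq_comm]
  have hMcard : M.card = if 0 < a then 1 else 0 := by
    rw [hM]
    split_ifs <;> simp
  have hlt : ∀ R ∈ twoIncSupports a w, ∀ x ∈ R, x < a := fun R hR => (mem_twoIncSupports.1 hR).1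
  have hnot : ∀ R ∈ twoIncSupports a w, a ∉ R := fun R hR h => (hlt R hR a h).false
  have hdecomp : twoIncSupports (a + b + 1) w =
      twoIncSupports a w ∪ ((twoIncSupports a w).image (insert a) ∪ (M ∪
        (twoIncSupports b fun i => w (i + a + 1)).image
          (Finset.map (addRightEmbedding (a + 1))))) := by
    ext S
    rw [hw.mem_twoIncSupports_iff ha]
    simp only [Finset.mem_union, Finset.mem_image, hMmem]
  have hne : ∀ R ∈ twoIncSupports a w, ∃ m ∈ R, m + 1 < a := by
    intro R hR
    obtain ⟨h, -, m, hm, hm1, -⟩ := mem_twoIncSupports.1 hR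
    exact ⟨m, hm, h _ hm1⟩
  have hgt : ∀ R : Finset ℕ, ∀ x ∈ R.map (addRightEmbedding (a + 1)), a < x := by
    intro R x hx
    obtain ⟨y, -, rfl⟩ := Finset.mem_map.1 hx
    simp only [addRightEmbedding_apply]
    omega
  have hdisj₁ : Disjoint (twoIncSupports a w) ((twoIncSupports a w).image (insert a) ∪ (M ∪
        (twoIncSupports b fun i => w (i + a + 1)).image
          (Finset.map (addRightEmbedding (a + 1))))) := by
    rw [Finset.disjoint_left]
    intro S hS hS'
    simp only [Finset.mem_union, Finset.mem_image, hMmem] at hS'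
    rcases hS' with ⟨R, hR, rfl⟩ | ⟨h0, rfl⟩ | ⟨R, hR, rfl⟩
    · exact hnot _ hS (Finset.mem_insert_self _ _)
    · exact hnot _ hS (by simp)
    · obtain ⟨m, hm, hma⟩ := hne _ hS
      have := hgt R m hm
      omega
  have hdisj₂ : Disjoint ((twoIncSupports a w).image (insert a)) (M ∪
        (twoIncSupports b fun i => w (i + a + 1)).image
          (Finset.map (addRightEmbedding (a + 1)))) := by
    rw [Finset.disjoint_left]
    intro S hS hS'
    simp only [Finset.mem_union, Finset.mem_image, hMmem] at hS hS'
    obtain ⟨Q, hQ, rfl⟩ := hS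
    obtain ⟨m, hm, hma⟩ := hne _ hQ
    rcases hS' with ⟨h0, h⟩ | ⟨R, hR, h⟩
    · have : m ∈ ({a - 1, a} : Finset ℕ) := h ▸ Finset.mem_insert_of_mem hm
      simp only [Finset.mem_insert, Finset.mem_singleton] at this
      omega
    · have := hgt R m (h ▸ Finset.mem_insert_of_mem hm)
      omega
  have hdisj₃ : Disjoint M ((twoIncSupports b fun i => w (i + a + 1)).image
          (Finset.map (addRightEmbedding (a + 1)))) := by
    rw [Finset.disjoint_left]
    intro S hS hS'
    obtain ⟨-, rfl⟩ := (hMmem S).1 hS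
    obtain ⟨R, -, h⟩ := Finset.mem_image.1 hS'
    exact (hgt R a (h ▸ by simp)).false
  rw [hdecomp, Finset.card_union_of_disjoint hdisj₁, Finset.card_union_of_disjoint hdisj₂,
    Finset.card_union_of_disjoint hdisj₃, hMcard, Finset.card_image_of_injOn,
    Finset.card_image_of_injective _ (Finset.map_injective _)]
  · ring
  · intro Q hQ R hR h
    rw [← Finset.erase_insert (hnot Q hQ), ← Finset.erase_insert (hnot R hR)]
    exact congrArg (fun S => S.erase a) h

theorem card_twoIncSupports_glueMax (hu : IsPerm132 a u) (hv : IsPerm132 b v) :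
    (twoIncSupports (a + b + 1) (glueMax a b u v)).card =
      2 * (twoIncSupports a u).card + (if 0 < a then 1 else 0) + (twoIncSupports b v).card := by
  rw [(isPerm132_glueMax hu hv).card_twoIncSupports glueMax_self,
    twoIncSupports_congr (n := a) (v := u)]
  · simp only [glueMax_add]
  · intro i hi j hj
    rw [glueMax_of_lt hi, glueMax_of_lt hj]
    omega

end glueMax

/-- Extension by zero of a finite sequence. -/
def zeroExtend {n : ℕ} (π : Fin n → ℤ) (i : ℕ) : ℤ := if h : i < n then π ⟨i, h⟩ else 0

@[simp] theorem zeroExtend_val {n : ℕ} (π : Fin n → ℤ) (x : Fin n) : zeroExtend π x = π x := by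
  simp [zeroExtend]

theorem zeroExtend_restrict {n i : ℕ} (u : ℕ → ℤ) (h : i < n) :
    zeroExtend (fun x : Fin n => u x) i = u i := by
  simp [zeroExtend, h]

open Classical in
/-- The permutations of length `n` avoiding 1-3-2. -/
noncomputable def perms132 (n : ℕ) : Finset (Fin n → ℤ) :=
  (Fintype.piFinset fun _ => Finset.Icc 1 (n : ℤ)).filter fun π => IsPermSeq n π ∧ Avoids132 π

theorem mem_perms132 {n : ℕ} {π : Fin n → ℤ} :
    π ∈ perms132 n ↔ IsPermSeq n π ∧ Avoids132 π := by
  simp only [perms132, Finset.mem_filter, Fintype.mem_piFinset, Finset.mem_Icc,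
    and_iff_right_iff_imp]
  exact fun h => h.1.2

theorem mem_perms132_iff_zeroExtend {n : ℕ} {π : Fin n → ℤ} :
    π ∈ perms132 n ↔ IsPerm132 n (zeroExtend π) := by
  simp [mem_perms132, isPerm132_iff]

theorem restrict_mem_perms132 {n : ℕ} {u : ℕ → ℤ} :
    (fun x : Fin n => u x) ∈ perms132 n ↔ IsPerm132 n u := by
  rw [mem_perms132, isPerm132_iff]

theorem totE_eq_card_zeroExtend {n : ℕ} (π : Fin n → ℤ) :
    totE π = (twoIncSupports n (zeroExtend π)).card := by
  simp [← totE_eq_card_twoIncSupports]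

theorem sum_totE_perms132_max_at (a b : ℕ) :
    ∑ π ∈ perms132 (a + b + 1) with zeroExtend π a = a + b + 1,
        (Polynomial.X : Polynomial ℤ) ^ totE π =
      Polynomial.X ^ (if 0 < a then 1 else 0) *
        ((∑ σ ∈ perms132 a, Polynomial.X ^ totE σ).comp (Polynomial.X ^ 2) *
          ∑ τ ∈ perms132 b, Polynomial.X ^ totE τ) := by
  rw [Polynomial.sum_comp, Finset.sum_mul_sum, ← Finset.sum_product', Finset.mul_sum]
  symm
  refine Finset.sum_bij'
    (fun p _ => fun x : Fin (a + b + 1) => glueMax a b (zeroExtend p.1) (zeroExtend p.2) x)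
    (fun π _ => (fun x : Fin a => zeroExtend π x - b, fun x : Fin b => zeroExtend π (x + a + 1)))
    ?_ ?_ ?_ ?_ ?_
  · rintro ⟨σ, τ⟩ h
    rw [Finset.mem_product, mem_perms132_iff_zeroExtend, mem_perms132_iff_zeroExtend] at h
    rw [Finset.mem_filter, restrict_mem_perms132, zeroExtend_restrict _ (by omega)]
    exact ⟨isPerm132_glueMax h.1 h.2, glueMax_self⟩
  · intro π h
    rw [Finset.mem_filter, mem_perms132_iff_zeroExtend] at h
    rw [Finset.mem_product]
    exact ⟨restrict_mem_perms132.2 (h.1.left h.2), restrict_mem_perms132.2 (h.1.right h.2)⟩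
  · rintro ⟨σ, τ⟩ -
    refine Prod.ext (funext fun x => ?_) (funext fun x => ?_)
    · dsimp only
      rw [zeroExtend_restrict _ (by omega), glueMax_of_lt x.2]
      simp
    · dsimp only
      rw [zeroExtend_restrict _ (by omega), glueMax_add]
      simp
  · intro π h
    have hmax := (Finset.mem_filter.1 h).2
    funext x
    rw [← zeroExtend_val π x]
    rcases lt_trichotomy (x : ℕ) a with hx | hx | hx
    · rw [glueMax_of_lt hx, zeroExtend_restrict (fun i => zeroExtend π i - b) hx]
      ring
    · rw [hx, glueMax_self, hmax]
    · obtain ⟨y, hy⟩ : ∃ y, (x : ℕ) = y + a + 1 := ⟨x - a - 1, by omega⟩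
      rw [hy, glueMax_add, zeroExtend_restrict (fun i => zeroExtend π (i + a + 1)) (by omega)]
  · rintro ⟨σ, τ⟩ h
    rw [Finset.mem_product, mem_perms132_iff_zeroExtend, mem_perms132_iff_zeroExtend] at h
    rw [totE_eq_card_twoIncSupports, card_twoIncSupports_glueMax h.1 h.2,
      ← totE_eq_card_zeroExtend, ← totE_eq_card_zeroExtend]
    simp only [Polynomial.X_pow_comp]
    ring

theorem existsUnique_max_perms132 {n : ℕ} {π : Fin (n + 1) → ℤ} (h : π ∈ perms132 (n + 1)) :
    ∃ a < n + 1, zeroExtend π a = n + 1 ∧ ∀ c < n + 1, zeroExtend π c = n + 1 → c = a := by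
  have hπ := mem_perms132_iff_zeroExtend.1 h
  have himage : (Finset.range (n + 1)).image (zeroExtend π) = Finset.Icc 1 ((n : ℤ) + 1) := by
    refine Finset.eq_of_subset_of_card_le ?_ ?_
    · intro y hy
      obtain ⟨i, hi, rfl⟩ := Finset.mem_image.1 hy
      have hi' := Finset.mem_range.1 hi
      exact Finset.mem_Icc.2 ⟨hπ.pos i hi', by simpa using hπ.le i hi'⟩
    · rw [Finset.card_image_of_injOn, Int.card_Icc, Finset.card_range]
      · omega
      · intro i hi j hj hij
        exact hπ.inj i (by simpa using hi) j (by simpa using hj) hij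
  have hmem : (n : ℤ) + 1 ∈ (Finset.range (n + 1)).image (zeroExtend π) := by
    rw [himage, Finset.mem_Icc]
    omega
  obtain ⟨a, ha, hmax⟩ := Finset.mem_image.1 hmem
  have ha' := Finset.mem_range.1 ha
  exact ⟨a, ha', hmax, fun c hc hcmax => hπ.inj c hc a ha' (hcmax.trans hmax.symm)⟩

theorem sum_perms132_succ {M : Type*} [AddCommMonoid M] (n : ℕ) (f : (Fin (n + 1) → ℤ) → M) :
    ∑ π ∈ perms132 (n + 1), f π =
      ∑ a ∈ Finset.range (n + 1),
        ∑ π ∈ perms132 (n + 1) with zeroExtend π a = n + 1, f π := by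
  simp only [Finset.sum_filter]
  rw [Finset.sum_comm]
  refine Finset.sum_congr rfl fun π h => ?_
  obtain ⟨a, ha, hmax, huniq⟩ := existsUnique_max_perms132 h
  rw [Finset.sum_eq_single_of_mem a (Finset.mem_range.2 ha), if_pos hmax]
  exact fun c hc hca => if_neg fun h' => hca (huniq c (Finset.mem_range.1 hc) h')

theorem coeff_sum_totE_perms132 (n k : ℕ) :
    (∑ π ∈ perms132 n, (Polynomial.X : Polynomial ℤ) ^ totE π).coeff k =
      (Nat.card {π : Fin n → ℤ // IsPermSeq n π ∧ Avoids132 π ∧ totE π = k} : ℤ) := by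
  have hcard : Nat.card {π : Fin n → ℤ // IsPermSeq n π ∧ Avoids132 π ∧ totE π = k} =
      ((perms132 n).filter fun π => k = totE π).card := by
    rw [← Nat.card_eq_finsetCard]
    refine Nat.card_congr (Equiv.subtypeEquivRight fun π => ?_)
    rw [Finset.mem_filter, mem_perms132, and_assoc, eq_comm (a := k)]
  rw [hcard, Polynomial.finsetSum_coeff]
  simp [Polynomial.coeff_X_pow]

theorem sum_totE_perms132_zero :
    ∑ π ∈ perms132 0, (Polynomial.X : Polynomial ℤ) ^ totE π = 1 := by
  have hmem : ∀ π, π ∈ perms132 0 := fun π =>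
    mem_perms132.2 ⟨⟨fun x => x.elim0, fun x => x.elim0⟩, fun x => x.elim0⟩
  rw [Finset.eq_univ_of_forall hmem, Fintype.sum_unique, totE_eq_card_zeroExtend]
  have hempty (u : ℕ → ℤ) : twoIncSupports 0 u = ∅ := by
    refine Finset.eq_empty_of_forall_notMem fun S hS => ?_
    obtain ⟨hlt, -, m, hm, -⟩ := mem_twoIncSupports.1 hS
    exact Nat.not_lt_zero _ (hlt m hm)
  rw [hempty, Finset.card_empty, pow_zero]

/-- The polynomials `P_n(x) = Σ_{π ∈ S_n(1-3-2)} x^{s(π)}`,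
where `s(π)` is the total number of 2-increasing subsequences of `π`, satisfy
`P_{n+1}(x) = P_n(x) + x · Σ_{a+b=n, a≥1} P_a(x²)·P_b(x)`. -/
theorem totE_polynomial_recurrence (P : ℕ → Polynomial ℤ)
    (hP : ∀ n k, (P n).coeff k =
      (Nat.card {π : Fin n → ℤ // IsPermSeq n π ∧ Avoids132 π ∧ totE π = k} : ℤ)) :
    ∀ n, P (n + 1) =
      P n + Polynomial.X *
        ∑ a ∈ Finset.Icc 1 n, (P a).comp (Polynomial.X ^ 2) * P (n - a) := by
  obtain rfl : P = fun n => ∑ π ∈ perms132 n, Polynomial.X ^ totE π :=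
    funext fun n => Polynomial.ext fun k => by rw [hP, coeff_sum_totE_perms132]
  intro n
  have hterm : ∀ a ∈ Finset.range (n + 1),
      ∑ π ∈ perms132 (n + 1) with zeroExtend π a = n + 1,
          (Polynomial.X : Polynomial ℤ) ^ totE π =
        Polynomial.X ^ (if 0 < a then 1 else 0) *
          ((∑ σ ∈ perms132 a, Polynomial.X ^ totE σ).comp (Polynomial.X ^ 2) *
            ∑ τ ∈ perms132 (n - a), Polynomial.X ^ totE τ) := by
    intro a ha
    obtain ⟨b, rfl⟩ := Nat.exists_eq_add_of_le (Nat.lt_succ_iff.1 (Finset.mem_range.1 ha))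
    rw [Nat.add_sub_cancel_left, ← sum_totE_perms132_max_at]
    push_cast
    rfl
  change ∑ π ∈ perms132 (n + 1), (Polynomial.X : Polynomial ℤ) ^ totE π = _
  rw [sum_perms132_succ, Finset.sum_congr rfl hterm, Finset.sum_range_eq_add_Ico _ n.add_one_pos,
    Finset.Ico_add_one_right_eq_Icc]
  congr 1
  · rw [sum_totE_perms132_zero]
    simp
  · rw [Finset.mul_sum]
    refine Finset.sum_congr rfl fun a ha => ?_
    rw [if_pos (show 0 < a from (Finset.mem_Icc.1 ha).1), pow_one]
end
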